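/- arXiv:1401.1917 — 2 statements merged into one kernel-verified Lean document; each statement's English description precedes it below -/
import Mathlib

section
/- Let U := {x ∈ ℝⁿ : g_i(x) = 0 for i = 1,…,m₁ and g_j(x) ≥ 0 for j = 1,…,m₂}, where each inequality-generator g_j has even degree. Suppose U is not compact. If conv(closure(Ũᵒ)) is closed and pointed, then U is not closed at ∞, i.e. closure(Ũᵒ) ≠ Ũᶜ. -/
open MvPolynomial Pointwise

/-- Homogenization of a polynomial in variables `X₁,…,Xₙ` (indexed by `Fin n`, shifted to
`X₁,…,Xₙ` via `Fin.succ`) with a new homogenizing variable `X₀`. -/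
noncomputable def homog {n : ℕ} (f : MvPolynomial (Fin n) ℝ) : MvPolynomial (Fin (n + 1)) ℝ :=
  ∑ α ∈ f.support,
    MvPolynomial.monomial
      (Finsupp.mapDomain Fin.succ α + Finsupp.single 0 (f.totalDegree - α.sum fun _ e => e))
      (MvPolynomial.coeff α f)

/-- The `k`-th truncated quadratic module generated by the family `g`. -/
def QMod {τ ι : Type*} [Fintype ι] (k : ℕ) (g : ι → MvPolynomial τ ℝ) :
    Set (MvPolynomial τ ℝ) :=
  {p | ∃ s₀ : MvPolynomial τ ℝ, ∃ s : ι → MvPolynomial τ ℝ,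
      IsSumSq s₀ ∧ s₀.totalDegree ≤ 2 * k ∧
      (∀ i, IsSumSq (s i) ∧ (s i * g i).totalDegree ≤ 2 * k) ∧
      p = s₀ + ∑ i, s i * g i}

/-- The homogenized generating family `G̃`. -/
noncomputable def tGens {n : ℕ} {ι : Type*} (g : ι → MvPolynomial (Fin n) ℝ) :
    ι ⊕ Fin 3 → MvPolynomial (Fin (n + 1)) ℝ :=
  Sum.elim (fun j => homog (g j))
    ![X 0, (∑ i, X i ^ 2) - 1, 1 - ∑ i, X i ^ 2]

/-- The modified theta body `TH̃ₖ(G̃)`. -/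
noncomputable def thetaB {n : ℕ} {ι : Type*} [Fintype ι] (k : ℕ)
    (g : ι → MvPolynomial (Fin n) ℝ) : Set (Fin n → ℝ) :=
  {x | ∀ l ∈ QMod k (tGens g), l.IsHomogeneous 1 → 0 ≤ eval (Fin.cons 1 x) l}

/-- The Riesz functional of a truncated moment sequence. -/
noncomputable def riesz {m : ℕ} (y : (Fin m →₀ ℕ) → ℝ) (p : MvPolynomial (Fin m) ℝ) : ℝ :=
  ∑ α ∈ p.support, MvPolynomial.coeff α p * y α

/-- The moment relaxation `Ωₖ(G̃)`. -/
noncomputable def omegaRel {n : ℕ} {ι : Type*} [Fintype ι] (k : ℕ)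
    (g : ι → MvPolynomial (Fin n) ℝ) : Set (Fin n → ℝ) :=
  {x | ∃ y : (Fin (n + 1) →₀ ℕ) → ℝ,
      riesz y (X 0) = 1 ∧
      (∀ i : Fin n, riesz y (X i.succ) = x i) ∧
      (∀ q : MvPolynomial (Fin (n + 1)) ℝ, q.totalDegree ≤ k → 0 ≤ riesz y (q ^ 2)) ∧
      (∀ q : MvPolynomial (Fin (n + 1)) ℝ, q.totalDegree ≤ k - 1 → 0 ≤ riesz y (X 0 * q ^ 2)) ∧
      (∀ q : MvPolynomial (Fin (n + 1)) ℝ, q.totalDegree ≤ 2 * (k - 1) →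
        riesz y (((∑ i, X i ^ 2) - 1) * q) = 0) ∧
      (∀ j : ι, ∀ q : MvPolynomial (Fin (n + 1)) ℝ,
        q.totalDegree ≤ k - ((g j).totalDegree + 1) / 2 → 0 ≤ riesz y (homog (g j) * q ^ 2))}

/-- The basic semialgebraic set defined by the family `g`. -/
def semiS {n : ℕ} {ι : Type*} (g : ι → MvPolynomial (Fin n) ℝ) : Set (Fin n → ℝ) :=
  {x | ∀ j, 0 ≤ eval x (g j)}

/-- `S̃ᵒ`. -/
noncomputable def StO {n : ℕ} {ι : Type*} (g : ι → MvPolynomial (Fin n) ℝ) :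
    Set (Fin (n + 1) → ℝ) :=
  {x | (∀ j, 0 ≤ eval x (homog (g j))) ∧ 0 < x 0}

/-- `S̃ᶜ`. -/
noncomputable def StC {n : ℕ} {ι : Type*} (g : ι → MvPolynomial (Fin n) ℝ) :
    Set (Fin (n + 1) → ℝ) :=
  {x | (∀ j, 0 ≤ eval x (homog (g j))) ∧ 0 ≤ x 0}

/-- `S̃ = S̃ᶜ ∩ {‖x̃‖₂ = 1}`. -/
noncomputable def StS {n : ℕ} {ι : Type*} (g : ι → MvPolynomial (Fin n) ℝ) :
    Set (Fin (n + 1) → ℝ) :=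
  {x | (∀ j, 0 ≤ eval x (homog (g j))) ∧ 0 ≤ x 0 ∧ ∑ i, x i ^ 2 = 1}

/-- Assumption A: `S` is closed at infinity, and `conv(closure(S̃ᵒ))` is closed and pointed. -/
noncomputable def AssumpA {n : ℕ} {ι : Type*} (g : ι → MvPolynomial (Fin n) ℝ) : Prop :=
  closure (StO g) = StC g ∧ IsClosed (convexHull ℝ (closure (StO g))) ∧
    convexHull ℝ (closure (StO g)) ∩ -(convexHull ℝ (closure (StO g))) = {0}

/-- The PP-BDR property with order `k` for the set `T ⊆ ℝⁿ⁺¹` relative to the homogenized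
generating family `tGens g`: outside a Lebesgue-null set of coefficient vectors, every affine
polynomial positive on `T` lies in the `k`-th truncated quadratic module of `G̃`. -/
noncomputable def ppBDR {n : ℕ} {ι : Type*} [Fintype ι] (k : ℕ)
    (g : ι → MvPolynomial (Fin n) ℝ) (T : Set (Fin (n + 1) → ℝ)) : Prop :=
  MeasureTheory.volume {c : Fin (n + 2) → ℝ |
    (∀ x ∈ T, 0 < c 0 + ∑ i : Fin (n + 1), c i.succ * x i) ∧
    (C (c 0) + ∑ i : Fin (n + 1), C (c i.succ) * X i) ∉ QMod k (tGens g)} = 0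

theorem homog_isHomogeneous {n : ℕ} (f : MvPolynomial (Fin n) ℝ) :
    (homog f).IsHomogeneous f.totalDegree := by
  unfold homog
  apply MvPolynomial.IsHomogeneous.sum
  intro α hα
  apply MvPolynomial.isHomogeneous_monomial
  have h := MvPolynomial.le_totalDegree hα
  have h2 : (Finsupp.mapDomain Fin.succ α : Fin (n+1) →₀ ℕ).degree = α.sum fun _ e => e := by
    have h3 : (Finsupp.mapDomain Fin.succ α : Fin (n+1) →₀ ℕ).degree =
        (Finsupp.mapDomain Fin.succ α : Fin (n+1) →₀ ℕ).sum fun _ e => e := rfl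
    rw [h3, Finsupp.sum_mapDomain_index (by simp) (by simp)]
  rw [map_add, h2, Finsupp.degree_single]
  omega

theorem eval_smul_homog {n : ℕ} (f : MvPolynomial (Fin n) ℝ) (t : ℝ) (x : Fin (n + 1) → ℝ) :
    eval (t • x) (homog f) = t ^ f.totalDegree * eval x (homog f) := by
  have h := homog_isHomogeneous f
  rw [eval_eq, eval_eq, Finset.mul_sum]
  refine Finset.sum_congr rfl fun d hd => ?_
  have hdeg : ∑ i ∈ d.support, d i = f.totalDegree := by
    have := h (mem_support_iff.mp hd)
    rw [← this]
    simp [Finsupp.weight_apply, Finsupp.sum]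
  simp only [Pi.smul_apply, smul_eq_mul, mul_pow, Finset.prod_mul_distrib]
  rw [Finset.prod_pow_eq_pow_sum, hdeg]
  ring

theorem eval_cons_homog {n : ℕ} (f : MvPolynomial (Fin n) ℝ) (x : Fin n → ℝ) :
    eval (Fin.cons 1 x : Fin (n + 1) → ℝ) (homog f) = eval x f := by
  unfold homog
  rw [map_sum, eval_eq]
  refine Finset.sum_congr rfl fun d hd => ?_
  rw [eval_monomial, Finsupp.prod_add_index' (by simp) (by intros; rw [pow_add]),
    Finsupp.prod_mapDomain_index (by simp) (by intros; rw [pow_add]),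
    Finsupp.prod_single_index (by simp)]
  simp [Finsupp.prod]

/-- Proposition 4.1: let `U` be given by equalities `g_i = 0` and inequalities `g_j ≥ 0`
where each inequality generator has even degree. If `U` is not compact and
`conv (closure Ũᵒ)` is closed and pointed, then `U` is not closed at infinity, i.e.
`closure Ũᵒ ≠ Ũᶜ`. -/
theorem stmt14 (n m₁ m₂ : ℕ) (geq : Fin m₁ → MvPolynomial (Fin n) ℝ)
    (gge : Fin m₂ → MvPolynomial (Fin n) ℝ)
    (heven : ∀ j, Even ((gge j).totalDegree))
    (hnc : ¬ IsCompact {x : Fin n → ℝ | (∀ i, eval x (geq i) = 0) ∧ ∀ j, 0 ≤ eval x (gge j)}) :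
    letI UtO : Set (Fin (n + 1) → ℝ) := {x | (∀ i, eval x (homog (geq i)) = 0) ∧
      (∀ j, 0 ≤ eval x (homog (gge j))) ∧ 0 < x 0}
    letI UtC : Set (Fin (n + 1) → ℝ) := {x | (∀ i, eval x (homog (geq i)) = 0) ∧
      (∀ j, 0 ≤ eval x (homog (gge j))) ∧ 0 ≤ x 0}
    IsClosed (convexHull ℝ (closure UtO)) →
    convexHull ℝ (closure UtO) ∩ -(convexHull ℝ (closure UtO)) = {0} →
    closure UtO ≠ UtC := by
  intro _ hpt heq
  set U : Set (Fin n → ℝ) := {x | (∀ i, eval x (geq i) = 0) ∧ ∀ j, 0 ≤ eval x (gge j)} with hU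
  have hUc : IsClosed U := by
    have e : U = (⋂ i, {x | eval x (geq i) = 0}) ∩ ⋂ j, {x | 0 ≤ eval x (gge j)} := by
      ext x; simp [hU]
    rw [e]
    exact (isClosed_iInter fun i => isClosed_eq (MvPolynomial.continuous_eval _) continuous_const).inter
      (isClosed_iInter fun j => isClosed_le continuous_const (MvPolynomial.continuous_eval _))
  have hub : ∀ k : ℕ, ∃ x ∈ U, (k : ℝ) < ‖x‖ := by
    by_contra! hcon
    obtain ⟨k, hk⟩ := hcon
    exact hnc (Metric.isCompact_of_isClosed_isBounded hUc
      (isBounded_iff_forall_norm_le.mpr ⟨k, hk⟩))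
  choose x hxU hxk using hub
  set z : ℕ → Fin (n + 1) → ℝ := fun k => Fin.cons 1 (x k) with hz
  have hzx : ∀ k, ‖x k‖ ≤ ‖z k‖ := by
    intro k
    refine (pi_norm_le_iff_of_nonneg (norm_nonneg _)).mpr fun i => ?_
    have := norm_le_pi_norm (z k) i.succ
    simpa [hz] using this
  have hzpos : ∀ k, 0 < ‖z k‖ := fun k =>
    lt_of_le_of_lt (Nat.cast_nonneg k) ((hxk k).trans_le (hzx k))
  have hw : ∀ k, ‖z k‖⁻¹ • z k ∈ Metric.sphere (0 : Fin (n + 1) → ℝ) 1 := by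
    intro k
    rw [mem_sphere_zero_iff_norm, norm_smul, norm_inv, norm_norm,
      inv_mul_cancel₀ (hzpos k).ne']
  obtain ⟨w, hwS, φ, hφ, hlim⟩ := (isCompact_sphere (0 : Fin (n + 1) → ℝ) 1).tendsto_subseq hw
  have hzt : Filter.Tendsto (fun k => ‖z k‖) Filter.atTop Filter.atTop :=
    Filter.tendsto_atTop_mono (fun k => ((hxk k).trans_le (hzx k)).le) tendsto_natCast_atTop_atTop
  have hw0 : w 0 = 0 := by
    have h1 := (tendsto_pi_nhds.mp hlim) 0
    have h2 : Filter.Tendsto (fun k => ‖z (φ k)‖⁻¹) Filter.atTop (nhds 0) :=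
      (tendsto_inv_atTop_zero.comp hzt).comp hφ.tendsto_atTop
    refine tendsto_nhds_unique h1 (h2.congr fun k => ?_)
    simp [hz]
  have hwcl := mem_closure_of_tendsto hlim (Filter.Eventually.of_forall fun k =>
    (show (‖z (φ k)‖⁻¹ • z (φ k)) ∈ {x : Fin (n + 1) → ℝ | (∀ i, eval x (homog (geq i)) = 0) ∧
      (∀ j, 0 ≤ eval x (homog (gge j))) ∧ 0 < x 0} from by
      refine ⟨fun i => ?_, fun j => ?_, ?_⟩
      · rw [eval_smul_homog, hz, eval_cons_homog, (hxU (φ k)).1 i, mul_zero]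
      · rw [eval_smul_homog, hz, eval_cons_homog]
        exact mul_nonneg (pow_nonneg (inv_nonneg.mpr (norm_nonneg _)) _) ((hxU (φ k)).2 j)
      · have := inv_pos.mpr (hzpos (φ k))
        simpa [hz] using this))
  have hwC := hwcl
  rw [heq] at hwC
  obtain ⟨a, b, c⟩ := hwC
  have hneg : -w ∈ closure {x : Fin (n + 1) → ℝ | (∀ i, eval x (homog (geq i)) = 0) ∧
      (∀ j, 0 ≤ eval x (homog (gge j))) ∧ 0 < x 0} := by
    rw [heq, ← neg_one_smul ℝ w]
    refine ⟨fun i => ?_, fun j => ?_, ?_⟩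
    · rw [eval_smul_homog, a i, mul_zero]
    · rw [eval_smul_homog, (heven j).neg_one_pow, one_mul]
      exact b j
    · simp [hw0]
  have hmem := hpt.subset ⟨subset_convexHull ℝ _ hwcl,
    Set.mem_neg.mpr (subset_convexHull ℝ _ hneg)⟩
  rw [Set.mem_singleton_iff] at hmem
  rw [hmem] at hwS
  simp at hwS
end

section
/- Let S := {(x₁,x₂) ∈ ℝ² : x₂³ − x₁² ≥ 0} with the single generator g = X₂³ − X₁², and let G̃ := {X₀, X₂³ − X₀X₁², X₀²+X₁²+X₂²−1, 1−X₀²−X₁²−X₂²}. Then: (i) S is closed at ∞, but conv(closure(S̃ᵒ)) is not pointed (both (0,1,0) and (0,−1,0) lie in closure(S̃ᵒ)); (ii) for every k ∈ ℕ, every homogeneous linear polynomial c₀X₀ + c₁X₁ + c₂X₂ belonging to Q_k(G̃) satisfies c₁ = c₂ = 0, and consequently TH̃_k(G̃) = ℝ² for every k, whereas closure(conv(S)) = {(x₁,x₂) : x₂ ≥ 0}. -/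
open MvPolynomial Pointwise

lemma isSumSq_eval_nonneg {τ : Type*} {p : MvPolynomial τ ℝ} (hp : IsSumSq p) (v : τ → ℝ) :
    0 ≤ eval v p := by
  induction hp with
  | zero => simp
  | sq_add a hs ih =>
    rw [map_add, map_mul]
    exact add_nonneg (mul_self_nonneg _) ih

lemma isHomogeneous_one_eq {l : MvPolynomial (Fin 3) ℝ} (hl : l.IsHomogeneous 1) :
    ∃ c₀ c₁ c₂ : ℝ, l = C c₀ * X 0 + C c₁ * X 1 + C c₂ * X 2 := by
  refine ⟨coeff (Finsupp.single 0 1) l, coeff (Finsupp.single 1 1) l,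
    coeff (Finsupp.single 2 1) l, ?_⟩
  ext d
  simp only [coeff_add, coeff_C_mul, coeff_X']
  by_cases hd : Finsupp.degree d = 1
  · replace hd := (Finsupp.sum_eq_one_iff d).mp hd
    obtain ⟨i, rfl⟩ := hd
    fin_cases i <;> simp [Finsupp.single_left_inj]
  · have h0 : ∀ i : Fin 3, Finsupp.single i 1 ≠ d := by
      rintro i rfl
      simp at hd
    rw [hl.coeff_eq_zero hd]
    simp [h0]

lemma not_forall_sin {h : ℝ → ℝ} (hc : Continuous h) (hs : ∀ t, 0 ≤ h t * Real.sin t) :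
    h 0 = 0 := by
  have hp := Real.pi_pos
  rcases lt_trichotomy (h 0) 0 with h0 | h0 | h0
  · exfalso
    have h1 := (hc.tendsto 0).eventually (gt_mem_nhds h0)
    rw [Metric.eventually_nhds_iff] at h1
    obtain ⟨e, he, h1⟩ := h1
    have hm : 0 < min (e / 2) 1 := by positivity
    have hm1 : min (e / 2) 1 ≤ 1 := min_le_right _ _
    have hm2 : min (e / 2) 1 ≤ e / 2 := min_le_left _ _
    have h2 : h (min (e / 2) 1) < 0 := h1 (by rw [Real.dist_eq, sub_zero, abs_of_pos hm]; linarith)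
    have h3 := Real.sin_pos_of_pos_of_lt_pi hm (by linarith [Real.pi_gt_three])
    have := hs (min (e / 2) 1)
    nlinarith
  · exact h0
  · exfalso
    have h1 := (hc.tendsto 0).eventually (lt_mem_nhds h0)
    rw [Metric.eventually_nhds_iff] at h1
    obtain ⟨e, he, h1⟩ := h1
    have hm : 0 < min (e / 2) 1 := by positivity
    have hm1 : min (e / 2) 1 ≤ 1 := min_le_right _ _
    have hm2 : min (e / 2) 1 ≤ e / 2 := min_le_left _ _
    have h2 : 0 < h (-min (e / 2) 1) :=
      h1 (by rw [Real.dist_eq, sub_zero, abs_neg, abs_of_pos hm]; linarith)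
    have h3 := Real.sin_pos_of_pos_of_lt_pi hm (by linarith [Real.pi_gt_three])
    have := hs (-min (e / 2) 1)
    rw [Real.sin_neg] at this
    nlinarith

lemma qmod_linear (k : ℕ) (c₀ c₁ c₂ : ℝ)
    (h : (C c₀ * X 0 + C c₁ * X 1 + C c₂ * X 2 : MvPolynomial (Fin 3) ℝ) ∈ QMod k
      (![X 0, X 2 ^ 3 - X 0 * X 1 ^ 2, X 0 ^ 2 + X 1 ^ 2 + X 2 ^ 2 - 1,
        1 - (X 0 ^ 2 + X 1 ^ 2 + X 2 ^ 2)] : Fin 4 → MvPolynomial (Fin 3) ℝ)) :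
    0 ≤ c₀ ∧ c₁ = 0 ∧ c₂ = 0 := by
  obtain ⟨s₀, s, hs₀, -, hs, he⟩ := h
  have key : ∀ v : Fin 3 → ℝ, v 0 ^ 2 + v 1 ^ 2 + v 2 ^ 2 = 1 →
      c₀ * v 0 + c₁ * v 1 + c₂ * v 2 =
        eval v s₀ + eval v (s 0) * v 0 + eval v (s 1) * (v 2 ^ 3 - v 0 * v 1 ^ 2) := by
    intro v hv
    have h1 := congrArg (eval v) he
    simp only [Fin.sum_univ_four, map_add, map_mul, eval_C, eval_X, Matrix.cons_val, map_sub,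
      map_pow, map_one, hv] at h1
    linarith
  have p0 := fun v => isSumSq_eval_nonneg hs₀ v
  have p1 := fun v => isSumSq_eval_nonneg (hs 0).1 v
  have hc0 : 0 ≤ c₀ := by
    have h1 := key ![1, 0, 0] (by simp)
    have h2 := p0 ![1, 0, 0]
    have h3 := p1 ![1, 0, 0]
    simp at h1
    linarith
  have hc1 : c₁ = 0 := by
    have h1 := key ![0, 1, 0] (by simp)
    have h2 := p0 ![0, 1, 0]
    have h3 := key ![0, -1, 0] (by simp)
    have h4 := p0 ![0, -1, 0]
    simp at h1 h3
    linarith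
  refine ⟨hc0, hc1, ?_⟩
  have hpath : Continuous (fun t : ℝ => (![0, Real.cos t, Real.sin t] : Fin 3 → ℝ)) := by
    refine continuous_pi fun i => ?_
    fin_cases i
    · exact continuous_const
    · exact Real.continuous_cos
    · exact Real.continuous_sin
  have hcont : Continuous (fun t : ℝ =>
      c₂ - eval (![0, Real.cos t, Real.sin t] : Fin 3 → ℝ) (s 1) * Real.sin t ^ 2) :=
    continuous_const.sub
      (((MvPolynomial.continuous_eval (s 1)).comp hpath).mul (Real.continuous_sin.pow 2))
  have := not_forall_sin hcont (fun t => by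
    have h1 := key ![0, Real.cos t, Real.sin t] (by simp)
    have h2 := p0 ![0, Real.cos t, Real.sin t]
    simp [hc1] at h1
    linarith)
  simpa using this

lemma closure_aux : closure {x : Fin 3 → ℝ | 0 ≤ x 2 ^ 3 - x 0 * x 1 ^ 2 ∧ 0 < x 0} =
    {x : Fin 3 → ℝ | 0 ≤ x 2 ^ 3 - x 0 * x 1 ^ 2 ∧ 0 ≤ x 0} := by
  apply Set.Subset.antisymm
  · apply closure_minimal
    · rintro x ⟨h1, h2⟩
      exact ⟨h1, h2.le⟩
    · exact IsClosed.inter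
        (isClosed_le (f := fun _ : Fin 3 → ℝ => (0 : ℝ))
          (g := fun x : Fin 3 → ℝ => x 2 ^ 3 - x 0 * x 1 ^ 2) continuous_const (by fun_prop))
        (isClosed_le (f := fun _ : Fin 3 → ℝ => (0 : ℝ))
          (g := fun x : Fin 3 → ℝ => x 0) continuous_const (by fun_prop))
  · rintro x ⟨h1, h2⟩
    rcases h2.eq_or_lt with h2 | h2
    · have hx2 : 0 ≤ x 2 := by
        rw [← h2] at h1
        by_contra hn
        have : x 2 ^ 3 < 0 := Odd.pow_neg (by decide) (not_le.mp hn)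
        linarith
      have hpath : Continuous
          (fun t : ℝ => (![t ^ 3, x 1, x 2 + t * (1 + x 1 ^ 2)] : Fin 3 → ℝ)) := by
        refine continuous_pi fun i => ?_
        fin_cases i
        · exact continuous_id.pow 3
        · exact continuous_const
        · exact continuous_const.add (continuous_id.mul continuous_const)
      have hlim := (hpath.tendsto 0).mono_left (nhdsWithin_le_nhds (s := Set.Ioi 0))
      have hx : (![(0:ℝ) ^ 3, x 1, x 2 + 0 * (1 + x 1 ^ 2)] : Fin 3 → ℝ) = x := by
        ext i
        fin_cases i <;> simp [← h2]
      rw [hx] at hlim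
      refine mem_closure_of_tendsto hlim ?_
      filter_upwards [self_mem_nhdsWithin] with t ht
      have ht : 0 < t := ht
      refine ⟨?_, ?_⟩
      · simp only [Matrix.cons_val]
        have e1 : (t * (1 + x 1 ^ 2)) ^ 3 ≤ (x 2 + t * (1 + x 1 ^ 2)) ^ 3 := by
          gcongr
          linarith
        have e2 : x 1 ^ 2 ≤ (1 + x 1 ^ 2) ^ 3 := by nlinarith [sq_nonneg (x 1), sq_nonneg (x 1 ^ 2), pow_nonneg (sq_nonneg (x 1)) 3]
        have e3 : t ^ 3 * x 1 ^ 2 ≤ t ^ 3 * (1 + x 1 ^ 2) ^ 3 := by gcongr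
        rw [mul_pow] at e1
        linarith
      · simp only [Matrix.cons_val]
        positivity
    · exact subset_closure ⟨h1, h2⟩

lemma closure_conv_aux : closure (convexHull ℝ {x : Fin 2 → ℝ | 0 ≤ x 1 ^ 3 - x 0 ^ 2}) =
    {x : Fin 2 → ℝ | 0 ≤ x 1} := by
  apply Set.Subset.antisymm
  · apply closure_minimal
    · apply convexHull_min
      · intro x hx
        have hx : 0 ≤ x 1 ^ 3 - x 0 ^ 2 := hx
        show 0 ≤ x 1
        by_contra hn
        have : x 1 ^ 3 < 0 := Odd.pow_neg (by decide) (not_le.mp hn)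
        nlinarith [sq_nonneg (x 0)]
      · intro x hx y hy a b ha hb _
        have hx : 0 ≤ x 1 := hx
        have hy : 0 ≤ y 1 := hy
        show 0 ≤ a * x 1 + b * y 1
        positivity
    · exact isClosed_le continuous_const (continuous_apply 1)
  · intro x hx
    have hx : 0 ≤ x 1 := hx
    have hpath : Continuous
        (fun t : ℝ => (![x 0, t * (1 + x 0 ^ 2) + (1 - t ^ 3) * x 1] : Fin 2 → ℝ)) := by
      refine continuous_pi fun i => ?_
      fin_cases i
      · exact continuous_const
      · show Continuous (fun t : ℝ => t * (1 + x 0 ^ 2) + (1 - t ^ 3) * x 1)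
        fun_prop
    have hlim := (hpath.tendsto 0).mono_left (nhdsWithin_le_nhds (s := Set.Ioi 0))
    have hx' : (![x 0, 0 * (1 + x 0 ^ 2) + (1 - 0 ^ 3) * x 1] : Fin 2 → ℝ) = x := by
      ext i
      fin_cases i <;> simp
    rw [hx'] at hlim
    refine mem_closure_of_tendsto hlim ?_
    filter_upwards [Ioo_mem_nhdsGT (zero_lt_one : (0:ℝ) < 1)] with t ht
    obtain ⟨ht, ht1⟩ := ht
    have hA : (![x 0 / t ^ 3, (1 + x 0 ^ 2) / t ^ 2] : Fin 2 → ℝ) ∈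
        {x : Fin 2 → ℝ | 0 ≤ x 1 ^ 3 - x 0 ^ 2} := by
      show 0 ≤ ((1 + x 0 ^ 2) / t ^ 2) ^ 3 - (x 0 / t ^ 3) ^ 2
      have e2 : x 0 ^ 2 ≤ (1 + x 0 ^ 2) ^ 3 := by nlinarith [sq_nonneg (x 0), sq_nonneg (x 0 ^ 2), pow_nonneg (sq_nonneg (x 0)) 3]
      have : ((1 + x 0 ^ 2) / t ^ 2) ^ 3 - (x 0 / t ^ 3) ^ 2 =
          ((1 + x 0 ^ 2) ^ 3 - x 0 ^ 2) / t ^ 6 := by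
        field_simp
      rw [this]
      exact div_nonneg (by linarith) (by positivity)
    have hB : (![0, x 1] : Fin 2 → ℝ) ∈ {x : Fin 2 → ℝ | 0 ≤ x 1 ^ 3 - x 0 ^ 2} := by
      show 0 ≤ x 1 ^ 3 - (0:ℝ) ^ 2
      have := pow_nonneg hx 3
      linarith
    have ht3 : t ^ 3 ≤ 1 := pow_le_one₀ ht.le ht1.le
    have := convex_convexHull ℝ {x : Fin 2 → ℝ | 0 ≤ x 1 ^ 3 - x 0 ^ 2}
      (subset_convexHull ℝ _ hA) (subset_convexHull ℝ _ hB) (a := t ^ 3) (b := 1 - t ^ 3)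
      (by positivity) (by linarith) (by ring)
    convert this using 1
    ext i
    fin_cases i
    · simp
      field_simp
    · simp
      field_simp

/-- Example 3.8: for `S = {x : x₂³ - x₁² ≥ 0}` with
`G̃ = {X₀, X₂³ - X₀X₁², X₀²+X₁²+X₂²-1, 1-X₀²-X₁²-X₂²}`: (i) `S` is closed at infinity but
`conv (closure S̃ᵒ)` is not pointed (both `(0,1,0)` and `(0,-1,0)` lie in `closure S̃ᵒ`);
(ii) every homogeneous linear `c₀X₀ + c₁X₁ + c₂X₂` in `Q_k(G̃)` has `c₁ = c₂ = 0`, hence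
`TH̃_k(G̃) = ℝ²` for every `k`, whereas `closure (conv S) = {x : x₂ ≥ 0}`. -/
theorem stmt18 :
    letI Gt : Fin 4 → MvPolynomial (Fin 3) ℝ :=
      ![X 0, X 2 ^ 3 - X 0 * X 1 ^ 2, X 0 ^ 2 + X 1 ^ 2 + X 2 ^ 2 - 1,
        1 - (X 0 ^ 2 + X 1 ^ 2 + X 2 ^ 2)]
    letI S : Set (Fin 2 → ℝ) := {x | 0 ≤ x 1 ^ 3 - x 0 ^ 2}
    letI StO : Set (Fin 3 → ℝ) := {x | 0 ≤ x 2 ^ 3 - x 0 * x 1 ^ 2 ∧ 0 < x 0}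
    letI StC : Set (Fin 3 → ℝ) := {x | 0 ≤ x 2 ^ 3 - x 0 * x 1 ^ 2 ∧ 0 ≤ x 0}
    letI TH : ℕ → Set (Fin 2 → ℝ) := fun k =>
      {x | ∀ l ∈ QMod k Gt, l.IsHomogeneous 1 → 0 ≤ eval (Fin.cons 1 x) l}
    closure StO = StC ∧
    (![(0 : ℝ), 1, 0] ∈ closure StO ∧ ![(0 : ℝ), -1, 0] ∈ closure StO) ∧
    ¬ (convexHull ℝ (closure StO) ∩ -(convexHull ℝ (closure StO)) = {0}) ∧
    (∀ k : ℕ, ∀ c₀ c₁ c₂ : ℝ,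
      (C c₀ * X 0 + C c₁ * X 1 + C c₂ * X 2) ∈ QMod k Gt → c₁ = 0 ∧ c₂ = 0) ∧
    (∀ k : ℕ, TH k = Set.univ) ∧
    closure (convexHull ℝ S) = {x : Fin 2 → ℝ | 0 ≤ x 1} := by
  have m1 : (![(0 : ℝ), 1, 0] : Fin 3 → ℝ) ∈
      closure {x : Fin 3 → ℝ | 0 ≤ x 2 ^ 3 - x 0 * x 1 ^ 2 ∧ 0 < x 0} := by
    rw [closure_aux]
    constructor <;> simp
  have m2 : (![(0 : ℝ), -1, 0] : Fin 3 → ℝ) ∈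
      closure {x : Fin 3 → ℝ | 0 ≤ x 2 ^ 3 - x 0 * x 1 ^ 2 ∧ 0 < x 0} := by
    rw [closure_aux]
    constructor <;> simp
  refine ⟨closure_aux, ⟨m1, m2⟩, ?_, ?_, ?_, closure_conv_aux⟩
  · intro h
    have h1 : (![(0 : ℝ), 1, 0] : Fin 3 → ℝ) ∈ ({0} : Set (Fin 3 → ℝ)) := by
      rw [← h]
      refine ⟨subset_convexHull ℝ _ m1, ?_⟩
      rw [Set.mem_neg]
      have : -(![(0 : ℝ), 1, 0] : Fin 3 → ℝ) = ![(0 : ℝ), -1, 0] := by simp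
      rw [this]
      exact subset_convexHull ℝ _ m2
    have h2 := congrFun (Set.mem_singleton_iff.mp h1) 1
    simp at h2
  · intro k c₀ c₁ c₂ h
    exact (qmod_linear k c₀ c₁ c₂ h).2
  · intro k
    refine Set.eq_univ_of_forall fun x l hl hh => ?_
    obtain ⟨c₀, c₁, c₂, rfl⟩ := isHomogeneous_one_eq hh
    obtain ⟨h0, rfl, rfl⟩ := qmod_linear k c₀ c₁ c₂ hl
    simpa using h0
end
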